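/- arXiv:2206.12499 — 2 statements merged into one kernel-verified Lean document; each statement's English description precedes it below -/
import Mathlib

section
/- Let k, ℓ ≥ 2. The number of (k,ℓ)-crucial permutations of length k+ℓ−3 (the minimal possible length of a (k,ℓ)-crucial permutation) equals the binomial coefficient C(k+ℓ−4, k−2). -/
/-- `σ` (in one-line notation, 0-based) has an increasing subsequence of length `k`,
i.e. contains an occurrence of the pattern `i_k`. -/
def HasIncr (k n : ℕ) (σ : Fin n → Fin n) : Prop :=
  ∃ f : Fin k → Fin n, StrictMono f ∧ StrictMono (σ ∘ f)

/-- `σ` has a decreasing subsequence of length `l`,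
i.e. contains an occurrence of the pattern `d_l`. -/
def HasDecr (l n : ℕ) (σ : Fin n → Fin n) : Prop :=
  ∃ f : Fin l → Fin n, StrictMono f ∧ StrictAnti (σ ∘ f)

/-- `σ` contains `i_k` or `d_l`. -/
def ContainsPat (k l n : ℕ) (σ : Fin n → Fin n) : Prop :=
  HasIncr k n σ ∨ HasDecr l n σ

/-- `σ` avoids both `i_k` and `d_l`. -/
def AvoidsPat (k l n : ℕ) (σ : Fin n → Fin n) : Prop :=
  ¬ HasIncr k n σ ∧ ¬ HasDecr l n σ

/-- The `i`-th extension of `σ` to the right (0-based): append the value `i` at the end,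
renaming old values via `Fin.succAbove i` (i.e. `x ↦ x` if `x < i`, `x ↦ x+1` if `x ≥ i`). -/
def rightExt {n : ℕ} (σ : Fin n → Fin n) (i : Fin (n + 1)) : Fin (n + 1) → Fin (n + 1) :=
  Fin.snoc (fun j => i.succAbove (σ j)) i

/-- The `i`-th extension of `σ` to the left: prepend the value `i`. -/
def leftExt {n : ℕ} (σ : Fin n → Fin n) (i : Fin (n + 1)) : Fin (n + 1) → Fin (n + 1) :=
  Fin.cons i (fun j => i.succAbove (σ j))

/-- The `i`-th extension of `σ` from above: insert the new maximum value at position `i`. -/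
def topExt {n : ℕ} (σ : Fin n → Fin n) (i : Fin (n + 1)) : Fin (n + 1) → Fin (n + 1) :=
  i.insertNth (Fin.last n) (fun j => (σ j).castSucc)

/-- The `i`-th extension of `σ` from below: insert the new minimum value at position `i`,
increasing all old values by one. -/
def botExt {n : ℕ} (σ : Fin n → Fin n) (i : Fin (n + 1)) : Fin (n + 1) → Fin (n + 1) :=
  i.insertNth 0 (fun j => (σ j).succ)

/-- `σ` is `(k,l)`-right-crucial (also called `(k,l)`-crucial): it avoids `i_k` and `d_l`,
but every extension of it to the right contains `i_k` or `d_l`. -/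
def RightCrucial (k l n : ℕ) (σ : Fin n → Fin n) : Prop :=
  AvoidsPat k l n σ ∧ ∀ i : Fin (n + 1), ContainsPat k l (n + 1) (rightExt σ i)

/-- `σ` is `(k,l)`-left-crucial. -/
def LeftCrucial (k l n : ℕ) (σ : Fin n → Fin n) : Prop :=
  AvoidsPat k l n σ ∧ ∀ i : Fin (n + 1), ContainsPat k l (n + 1) (leftExt σ i)

/-- `σ` is `(k,l)`-top-crucial. -/
def TopCrucial (k l n : ℕ) (σ : Fin n → Fin n) : Prop :=
  AvoidsPat k l n σ ∧ ∀ i : Fin (n + 1), ContainsPat k l (n + 1) (topExt σ i)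

/-- `σ` is `(k,l)`-bottom-crucial. -/
def BottomCrucial (k l n : ℕ) (σ : Fin n → Fin n) : Prop :=
  AvoidsPat k l n σ ∧ ∀ i : Fin (n + 1), ContainsPat k l (n + 1) (botExt σ i)

/-- `σ` is `(k,l)`-bicrucial: both right-crucial and left-crucial. -/
def Bicrucial (k l n : ℕ) (σ : Fin n → Fin n) : Prop :=
  RightCrucial k l n σ ∧ LeftCrucial k l n σ

/-- `σ` is `(k,l)`-top-right-crucial: right-crucial and every extension from above
contains `i_k` or `d_l`. -/
def TopRightCrucial (k l n : ℕ) (σ : Fin n → Fin n) : Prop :=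
  RightCrucial k l n σ ∧ ∀ i : Fin (n + 1), ContainsPat k l (n + 1) (topExt σ i)

/-- `σ` is `(k,l)`-tricrucial: bicrucial and every extension from above
contains `i_k` or `d_l`. -/
def Tricrucial (k l n : ℕ) (σ : Fin n → Fin n) : Prop :=
  Bicrucial k l n σ ∧ ∀ i : Fin (n + 1), ContainsPat k l (n + 1) (topExt σ i)

/-- `σ` is `(k,l)`-quadrocrucial: tricrucial and every extension from below
contains `i_k` or `d_l`. -/
def Quadrocrucial (k l n : ℕ) (σ : Fin n → Fin n) : Prop :=
  Tricrucial k l n σ ∧ ∀ i : Fin (n + 1), ContainsPat k l (n + 1) (botExt σ i)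


theorem ext_cs {n : ℕ} (σ : Fin n → Fin n) (i : Fin (n + 1)) (j : Fin n) :
    rightExt σ i j.castSucc = i.succAbove (σ j) := by simp [rightExt]

theorem ext_last {n : ℕ} (σ : Fin n → Fin n) (i : Fin (n + 1)) :
    rightExt σ i (Fin.last n) = i := by simp [rightExt]

theorem incr_of_ext {n k : ℕ} (σ : Fin n → Fin n) (i : Fin (n + 1))
    (h : HasIncr (k + 1) (n + 1) (rightExt σ i)) (h' : ¬ HasIncr (k + 1) n σ) :
    ∃ g : Fin k → Fin n, StrictMono g ∧ StrictMono (σ ∘ g) ∧ ∀ a, (σ (g a)).val < i.val := by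
  obtain ⟨f, hf, hs⟩ := h
  have key : ∀ a : Fin k, ∃ b : Fin n, b.castSucc = f a.castSucc := by
    intro a
    have h1 : f a.castSucc < f (Fin.last k) := hf (Fin.castSucc_lt_last a)
    exact Fin.exists_castSucc_eq.2 (ne_of_lt (lt_of_lt_of_le h1 (Fin.le_last _)))
  by_cases hl : f (Fin.last k) = Fin.last n
  · choose g hg using key
    refine ⟨g, ?_, ?_, ?_⟩
    · intro a b hab
      have := hf (Fin.castSucc_lt_castSucc_iff.2 hab)
      rw [← hg, ← hg] at this
      exact Fin.castSucc_lt_castSucc_iff.1 this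
    · intro a b hab
      have := hs (Fin.castSucc_lt_castSucc_iff.2 hab)
      simp only [Function.comp] at this
      rw [← hg, ← hg, ext_cs, ext_cs] at this
      exact (Fin.succAbove_lt_succAbove_iff).1 this
    · intro a
      have := hs (Fin.castSucc_lt_last a)
      simp only [Function.comp] at this
      rw [← hg, hl, ext_cs, ext_last] at this
      exact (Fin.succAbove_lt_iff_castSucc_lt _ _).1 this
  · exfalso
    apply h'
    have key2 : ∀ a : Fin (k + 1), ∃ b : Fin n, b.castSucc = f a := by
      intro a
      refine Fin.lastCases ?_ key a
      exact Fin.exists_castSucc_eq.2 hl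
    choose g hg using key2
    refine ⟨g, ?_, ?_⟩
    · intro a b hab
      have := hf hab
      rw [← hg, ← hg] at this
      exact Fin.castSucc_lt_castSucc_iff.1 this
    · intro a b hab
      have := hs hab
      simp only [Function.comp] at this
      rw [← hg, ← hg, ext_cs, ext_cs] at this
      exact (Fin.succAbove_lt_succAbove_iff).1 this

theorem decr_of_ext {n k : ℕ} (σ : Fin n → Fin n) (i : Fin (n + 1))
    (h : HasDecr (k + 1) (n + 1) (rightExt σ i)) (h' : ¬ HasDecr (k + 1) n σ) :
    ∃ g : Fin k → Fin n, StrictMono g ∧ StrictAnti (σ ∘ g) ∧ ∀ a, i.val ≤ (σ (g a)).val := by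
  obtain ⟨f, hf, hs⟩ := h
  have key : ∀ a : Fin k, ∃ b : Fin n, b.castSucc = f a.castSucc := by
    intro a
    have h1 : f a.castSucc < f (Fin.last k) := hf (Fin.castSucc_lt_last a)
    exact Fin.exists_castSucc_eq.2 (ne_of_lt (lt_of_lt_of_le h1 (Fin.le_last _)))
  by_cases hl : f (Fin.last k) = Fin.last n
  · choose g hg using key
    refine ⟨g, ?_, ?_, ?_⟩
    · intro a b hab
      have := hf (Fin.castSucc_lt_castSucc_iff.2 hab)
      rw [← hg, ← hg] at this
      exact Fin.castSucc_lt_castSucc_iff.1 this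
    · intro a b hab
      have := hs (Fin.castSucc_lt_castSucc_iff.2 hab)
      simp only [Function.comp] at this
      rw [← hg, ← hg, ext_cs, ext_cs] at this
      exact (Fin.succAbove_lt_succAbove_iff).1 this
    · intro a
      have := hs (Fin.castSucc_lt_last a)
      simp only [Function.comp] at this
      rw [← hg, hl, ext_cs, ext_last] at this
      exact (Fin.lt_succAbove_iff_le_castSucc _ _).1 this
  · exfalso
    apply h'
    have key2 : ∀ a : Fin (k + 1), ∃ b : Fin n, b.castSucc = f a := by
      intro a
      refine Fin.lastCases ?_ key a
      exact Fin.exists_castSucc_eq.2 hl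
    choose g hg using key2
    refine ⟨g, ?_, ?_⟩
    · intro a b hab
      have := hf hab
      rw [← hg, ← hg] at this
      exact Fin.castSucc_lt_castSucc_iff.1 this
    · intro a b hab
      have := hs hab
      simp only [Function.comp] at this
      rw [← hg, ← hg, ext_cs, ext_cs] at this
      exact (Fin.succAbove_lt_succAbove_iff).1 this

theorem ext_incr {n k : ℕ} (σ : Fin n → Fin n) (i : Fin (n + 1))
    (g : Fin k → Fin n) (hg : StrictMono g) (hs : StrictMono (σ ∘ g))
    (hi : ∀ a, (σ (g a)).val < i.val) : HasIncr (k + 1) (n + 1) (rightExt σ i) := by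
  refine ⟨Fin.snoc (α := fun _ => Fin (n + 1)) (fun a => (g a).castSucc) (Fin.last n), ?_, ?_⟩
  · intro a b hab
    induction b using Fin.lastCases with
    | last =>
      induction a using Fin.lastCases with
      | last => exact absurd hab (lt_irrefl _)
      | cast a => simp [Fin.castSucc_lt_last]
    | cast b =>
      induction a using Fin.lastCases with
      | last => exact absurd (hab.trans (Fin.castSucc_lt_last b)) (lt_irrefl _)
      | cast a =>
        simp only [Fin.snoc_castSucc, Fin.castSucc_lt_castSucc_iff] at *
        exact hg hab
  · intro a b hab
    induction b using Fin.lastCases with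
    | last =>
      induction a using Fin.lastCases with
      | last => exact absurd hab (lt_irrefl _)
      | cast a =>
        simp only [Function.comp, Fin.snoc_castSucc, Fin.snoc_last, ext_cs, ext_last]
        exact (Fin.succAbove_lt_iff_castSucc_lt _ _).2 (hi a)
    | cast b =>
      induction a using Fin.lastCases with
      | last => exact absurd (hab.trans (Fin.castSucc_lt_last b)) (lt_irrefl _)
      | cast a =>
        simp only [Function.comp, Fin.snoc_castSucc, ext_cs, Fin.succAbove_lt_succAbove_iff]
        exact hs (Fin.castSucc_lt_castSucc_iff.1 hab)

theorem ext_decr {n k : ℕ} (σ : Fin n → Fin n) (i : Fin (n + 1))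
    (g : Fin k → Fin n) (hg : StrictMono g) (hs : StrictAnti (σ ∘ g))
    (hi : ∀ a, i.val ≤ (σ (g a)).val) : HasDecr (k + 1) (n + 1) (rightExt σ i) := by
  refine ⟨Fin.snoc (α := fun _ => Fin (n + 1)) (fun a => (g a).castSucc) (Fin.last n), ?_, ?_⟩
  · intro a b hab
    induction b using Fin.lastCases with
    | last =>
      induction a using Fin.lastCases with
      | last => exact absurd hab (lt_irrefl _)
      | cast a => simp [Fin.castSucc_lt_last]
    | cast b =>
      induction a using Fin.lastCases with
      | last => exact absurd (hab.trans (Fin.castSucc_lt_last b)) (lt_irrefl _)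
      | cast a =>
        simp only [Fin.snoc_castSucc, Fin.castSucc_lt_castSucc_iff] at *
        exact hg hab
  · intro a b hab
    induction b using Fin.lastCases with
    | last =>
      induction a using Fin.lastCases with
      | last => exact absurd hab (lt_irrefl _)
      | cast a =>
        simp only [Function.comp, Fin.snoc_castSucc, Fin.snoc_last, ext_cs, ext_last]
        exact (Fin.lt_succAbove_iff_le_castSucc _ _).2 (hi a)
    | cast b =>
      induction a using Fin.lastCases with
      | last => exact absurd (hab.trans (Fin.castSucc_lt_last b)) (lt_irrefl _)
      | cast a =>
        simp only [Function.comp, Fin.snoc_castSucc, ext_cs, Fin.succAbove_lt_succAbove_iff]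
        exact hs (Fin.castSucc_lt_castSucc_iff.1 hab)

def NicePerm (p n : ℕ) (σ : Fin n → Fin n) : Prop :=
  ∀ i j : Fin n, i < j → ((σ i).val ≤ p → (σ j).val ≤ p → σ i < σ j) ∧
    (p ≤ (σ i).val → p ≤ (σ j).val → σ j < σ i)

theorem sm_ge {m n : ℕ} (f : Fin m → Fin n) (hf : StrictMono f) :
    ∀ (t : ℕ) (h : t < m), t ≤ (f ⟨t, h⟩).val := by
  intro t
  induction t with
  | zero => intro h; exact Nat.zero_le _
  | succ t ih =>
    intro h
    have h1 := ih (by omega)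
    have h2 : f ⟨t, by omega⟩ < f ⟨t + 1, h⟩ := hf (by simp [Fin.lt_def])
    rw [Fin.lt_def] at h2
    omega

theorem sa_le {m n : ℕ} (f : Fin m → Fin n) (hf : StrictAnti f) :
    ∀ (t : ℕ) (h : t < m), (f ⟨t, h⟩).val + t < n := by
  intro t
  induction t with
  | zero => intro h; exact (f _).isLt
  | succ t ih =>
    intro h
    have h1 := ih (by omega)
    have h2 : f ⟨t + 1, h⟩ < f ⟨t, by omega⟩ := hf (by simp [Fin.lt_def])
    rw [Fin.lt_def] at h2
    omega

theorem nice_crucial (p q : ℕ) (σ : Equiv.Perm (Fin (p + q + 1)))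
    (h : NicePerm p (p + q + 1) σ) : RightCrucial (p + 2) (q + 2) (p + q + 1) σ := by
  refine ⟨⟨?_, ?_⟩, ?_⟩
  · rintro ⟨f, hf, hs⟩
    have h1 := sm_ge _ hs p (by omega)
    have h2 := sm_ge _ hs (p + 1) (by omega)
    have hlt : (⟨p, by omega⟩ : Fin (p + 2)) < ⟨p + 1, by omega⟩ := by simp [Fin.lt_def]
    have h3 := (h _ _ (hf hlt)).2 h1 (by simp only [Function.comp] at h2; omega)
    exact absurd (hs hlt) (not_lt.2 h3.le)
  · rintro ⟨f, hf, hs⟩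
    have h1 := sa_le _ hs q (by omega)
    have h2 := sa_le _ hs (q + 1) (by omega)
    simp only [Function.comp] at h1 h2
    have hlt : (⟨q, by omega⟩ : Fin (q + 2)) < ⟨q + 1, by omega⟩ := by simp [Fin.lt_def]
    have h3 := (h _ _ (hf hlt)).1 (by omega) (by omega)
    exact absurd (hs hlt) (not_lt.2 h3.le)
  · intro i
    by_cases hi : p < i.val
    · left
      refine ext_incr σ i (fun a : Fin (p + 1) => σ.symm ⟨a.val, by omega⟩) ?_ ?_ ?_
      · intro a b hab
        by_contra hc
        rcases lt_or_eq_of_le (not_lt.1 hc) with hc | hc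
        · have := (h _ _ hc).1 (by simp; omega) (by simp; omega)
          simp only [Equiv.apply_symm_apply, Fin.lt_def] at this hab
          omega
        · have := congrArg Fin.val (σ.symm.injective hc)
          simp only [Fin.lt_def] at this hab
          omega
      · intro a b hab
        simp only [Function.comp, Equiv.apply_symm_apply]
        exact hab
      · intro a; simp; omega
    · right
      refine ext_decr σ i (fun a : Fin (q + 1) => σ.symm ⟨p + q - a.val, by omega⟩) ?_ ?_ ?_
      · intro a b hab
        by_contra hc
        rcases lt_or_eq_of_le (not_lt.1 hc) with hc | hc
        · have := (h _ _ hc).2 (by simp; omega) (by simp; omega)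
          simp only [Equiv.apply_symm_apply, Fin.lt_def] at this hab
          omega
        · have := congrArg Fin.val (σ.symm.injective hc)
          simp only [Fin.lt_def] at this hab
          omega
      · intro a b hab
        simp only [Function.comp, Equiv.apply_symm_apply, Fin.lt_def] at hab ⊢
        omega
      · intro a; simp; omega

theorem crucial_nice (p q : ℕ) (σ : Equiv.Perm (Fin (p + q + 1)))
    (h : RightCrucial (p + 2) (q + 2) (p + q + 1) σ) : NicePerm p (p + q + 1) σ := by
  classical
  obtain ⟨⟨hI, hD⟩, hE⟩ := h
  let P : ℕ → Prop := fun v => ∃ g : Fin (p + 1) → Fin (p + q + 1), StrictMono g ∧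
    StrictMono (σ ∘ g) ∧ (σ (g (Fin.last p))).val = v
  have hex : ∃ v, P v := by
    rcases hE (Fin.last _) with h | h
    · obtain ⟨g, h1, h2, _⟩ := incr_of_ext _ _ h hI
      exact ⟨_, g, h1, h2, rfl⟩
    · obtain ⟨g, h1, h2, h3⟩ := decr_of_ext _ _ h hD
      have := h3 (Fin.last q)
      have := (σ (g (Fin.last q))).isLt
      simp at *
      omega
  obtain ⟨g, g1, g2, g3⟩ := Nat.find_spec hex
  have hmin : ∀ v, P v → Nat.find hex ≤ v := fun v hv => Nat.find_min' hex hv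
  generalize Nat.find hex = m at g3 hmin
  have hmn : m < p + q + 1 := by rw [← g3]; exact Fin.isLt _
  have hd : ∃ g : Fin (q + 1) → Fin (p + q + 1), StrictMono g ∧ StrictAnti (σ ∘ g) ∧
      ∀ a, m ≤ (σ (g a)).val := by
    rcases hE ⟨m, by omega⟩ with h | h
    · obtain ⟨g, h1, h2, h3⟩ := incr_of_ext _ _ h hI
      have h4 := hmin _ ⟨g, h1, h2, rfl⟩
      have := h3 (Fin.last p)
      simp at this
      omega
    · exact decr_of_ext _ _ h hD
  obtain ⟨h, h1, h2, h3⟩ := hd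
  have hle : ∀ a, (σ (g a)).val ≤ m := by
    intro a
    rw [← g3]
    exact g2.monotone (Fin.le_last a)
  have ca : (Finset.univ.image (fun a => (σ (g a)).val)).card = p + 1 := by
    exact (Finset.card_image_of_injective _ (Fin.val_injective.comp g2.injective)).trans
      (by simp)
  have cb : (Finset.univ.image (fun a => (σ (h a)).val)).card = q + 1 := by
    exact (Finset.card_image_of_injective _ (Fin.val_injective.comp h2.injective)).trans
      (by simp)
  have sa : Finset.univ.image (fun a => (σ (g a)).val) ⊆ Finset.range (m + 1) := by
    intro x hx
    obtain ⟨a, _, rfl⟩ := Finset.mem_image.1 hx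
    have := hle a
    simp; omega
  have sb : Finset.univ.image (fun a => (σ (h a)).val) ⊆ Finset.Ico m (p + q + 1) := by
    intro x hx
    obtain ⟨a, _, rfl⟩ := Finset.mem_image.1 hx
    have := h3 a
    have := (σ (h a)).isLt
    simp; omega
  have la := Finset.card_le_card sa
  have lb := Finset.card_le_card sb
  rw [ca, Finset.card_range] at la
  rw [cb, Nat.card_Ico] at lb
  have hmp : m = p := by omega
  subst hmp
  have ea := Finset.eq_of_subset_of_card_le sa (by rw [ca, Finset.card_range])
  have eb := Finset.eq_of_subset_of_card_le sb (by rw [cb, Nat.card_Ico]; omega)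
  have ga : ∀ i, (σ i).val ≤ m → ∃ a, g a = i := by
    intro i hi
    have : (σ i).val ∈ Finset.range (m + 1) := by simp; omega
    rw [← ea] at this
    obtain ⟨a, _, ha⟩ := Finset.mem_image.1 this
    exact ⟨a, σ.injective (Fin.val_injective ha)⟩
  have gb : ∀ i, m ≤ (σ i).val → ∃ a, h a = i := by
    intro i hi
    have : (σ i).val ∈ Finset.Ico m (m + q + 1) := by
      rw [Finset.mem_Ico]; exact ⟨hi, (σ i).isLt⟩
    rw [← eb] at this
    obtain ⟨a, _, ha⟩ := Finset.mem_image.1 this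
    exact ⟨a, σ.injective (Fin.val_injective ha)⟩
  intro i j hij
  constructor
  · intro hi hj
    obtain ⟨a, rfl⟩ := ga i hi
    obtain ⟨b, rfl⟩ := ga j hj
    exact g2 (g1.lt_iff_lt.1 hij)
  · intro hi hj
    obtain ⟨a, rfl⟩ := gb i hi
    obtain ⟨b, rfl⟩ := gb j hj
    exact h2 (h1.lt_iff_lt.1 hij)

def RelS {n : ℕ} (S : Finset (Fin n)) (j i : Fin n) : Prop :=
  (j ∈ S ∧ i ∉ S) ∨ (j ∈ S ∧ i ∈ S ∧ j < i) ∨ (j ∉ S ∧ i ∉ S ∧ i < j)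

open Classical in
noncomputable def rankS {n : ℕ} (S : Finset (Fin n)) (i : Fin n) : ℕ :=
  (Finset.univ.filter (fun j => RelS S j i)).card

theorem rank_lt {n : ℕ} (S : Finset (Fin n)) {j i : Fin n} (h : RelS S j i) :
    rankS S j < rankS S i := by
  classical
  unfold rankS
  apply Finset.card_lt_card
  rw [Finset.ssubset_iff_of_subset]
  · refine ⟨j, by simpa using h, ?_⟩
    rw [Finset.mem_filter]
    simp [RelS]
  · intro x
    simp only [Finset.mem_filter, Finset.mem_univ, true_and]
    unfold RelS at *
    intro hx
    rcases h with h | h | h <;> rcases hx with hx | hx | hx <;> simp_all <;> grind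

theorem rank_inj {n : ℕ} (S : Finset (Fin n)) : Function.Injective (rankS S) := by
  intro a b hab
  by_contra hne
  have : RelS S a b ∨ RelS S b a := by
    unfold RelS
    rcases lt_or_gt_of_ne hne with h | h <;> by_cases ha : a ∈ S <;> by_cases hb : b ∈ S <;>
      simp [ha, hb, h]
  rcases this with h | h
  · have := rank_lt S h; omega
  · have := rank_lt S h; omega

theorem rank_bound {n : ℕ} (S : Finset (Fin n)) (i : Fin n) : rankS S i < n := by
  classical
  unfold rankS
  have : (Finset.univ.filter (fun j => RelS S j i)).card < (Finset.univ : Finset (Fin n)).card := by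
    apply Finset.card_lt_card
    rw [Finset.ssubset_iff_of_subset (Finset.filter_subset _ _)]
    exact ⟨i, by simp, by rw [Finset.mem_filter]; simp [RelS]⟩
  simpa using this

noncomputable def permS {n : ℕ} (S : Finset (Fin n)) : Equiv.Perm (Fin n) :=
  Equiv.ofBijective (fun i => ⟨rankS S i, rank_bound S i⟩)
    (Finite.injective_iff_bijective.1 (fun a b h => rank_inj S (by simpa using h)))

theorem permS_val {n : ℕ} (S : Finset (Fin n)) (i : Fin n) :
    (permS S i).val = rankS S i := rfl

theorem rank_mem {n : ℕ} (S : Finset (Fin n)) (i : Fin n) (h : i ∈ S) : rankS S i < S.card := by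
  classical
  unfold rankS
  apply Finset.card_lt_card
  rw [Finset.ssubset_iff_of_subset]
  · exact ⟨i, h, by rw [Finset.mem_filter]; simp [RelS]⟩
  · intro x
    simp only [Finset.mem_filter, Finset.mem_univ, true_and]
    unfold RelS
    tauto

theorem rank_not_mem {n : ℕ} (S : Finset (Fin n)) (i : Fin n) (h : i ∉ S) :
    S.card ≤ rankS S i := by
  classical
  unfold rankS
  apply Finset.card_le_card
  intro x
  simp only [Finset.mem_filter, Finset.mem_univ, true_and]
  unfold RelS
  tauto

theorem rank_not_mem' {n : ℕ} (S : Finset (Fin n)) (i j : Fin n) (h : i ∉ S) (hj : j ∉ S)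
    (hij : i < j) : S.card < rankS S i :=
  lt_of_le_of_lt (rank_not_mem S j hj) (rank_lt S (Or.inr (Or.inr ⟨hj, h, hij⟩)))

theorem permS_nice (p q : ℕ) (S : Finset (Fin (p + q + 1))) (hS : S.card = p)
    (hl : Fin.last (p + q) ∉ S) : NicePerm p (p + q + 1) (permS S) := by
  intro i j hij
  simp only [Fin.lt_def, permS_val]
  constructor
  · intro hi hj
    have him : i ∈ S := by
      by_contra hc
      have := rank_not_mem' S i _ hc hl (lt_of_lt_of_le hij (Fin.le_last j))
      omega
    apply rank_lt
    unfold RelS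
    tauto
  · intro hi hj
    have him : i ∉ S := by
      intro hc
      have := rank_mem S i hc
      omega
    have hjm : j ∉ S := by
      intro hc
      have := rank_mem S j hc
      omega
    apply rank_lt
    unfold RelS
    tauto

def lowS {n : ℕ} (p : ℕ) (σ : Equiv.Perm (Fin n)) : Finset (Fin n) :=
  Finset.univ.filter (fun i => (σ i).val < p)

theorem low_card (p q : ℕ) (σ : Equiv.Perm (Fin (p + q + 1))) : (lowS p σ).card = p := by
  have : (lowS p σ).image (fun i => (σ i).val) = Finset.range p := by
    ext x
    simp only [lowS, Finset.mem_image, Finset.mem_filter, Finset.mem_univ, true_and,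
      Finset.mem_range]
    constructor
    · rintro ⟨a, ha, rfl⟩; exact ha
    · intro hx
      exact ⟨σ.symm ⟨x, by omega⟩, by simpa using hx, by simp⟩
  rw [← Finset.card_image_of_injective (lowS p σ) (Fin.val_injective.comp σ.injective)]
  change ((lowS p σ).image (fun i => (σ i).val)).card = p
  rw [this, Finset.card_range]

theorem low_last (p q : ℕ) (σ : Equiv.Perm (Fin (p + q + 1)))
    (h : NicePerm p (p + q + 1) σ) : Fin.last (p + q) ∉ lowS p σ := by
  simp only [lowS, Finset.mem_filter, Finset.mem_univ, true_and]
  intro hc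
  have hv : (σ (σ.symm ⟨p, by omega⟩)).val = p := by simp
  have hne : σ.symm ⟨p, by omega⟩ < Fin.last (p + q) := by
    apply lt_of_le_of_ne (Fin.le_last _)
    intro he
    rw [he] at hv
    omega
  have := (h _ _ hne).1 (by omega) (by omega)
  rw [Fin.lt_def] at this
  omega

theorem perm_rank {n : ℕ} (σ : Equiv.Perm (Fin n)) (i : Fin n) :
    (Finset.univ.filter (fun j => σ j < σ i)).card = (σ i).val := by
  have : (Finset.univ.filter (fun j => σ j < σ i)).map σ.toEmbedding = Finset.Iio (σ i) := by
    ext x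
    simp only [Finset.mem_map, Finset.mem_filter, Finset.mem_univ, true_and, Finset.mem_Iio]
    constructor
    · rintro ⟨a, ha, rfl⟩; exact ha
    · intro hx
      exact ⟨σ.symm x, by simpa using hx, by simp⟩
  rw [← Finset.card_map σ.toEmbedding, this, Fin.card_Iio]

theorem nice_eq (p q : ℕ) (σ : Equiv.Perm (Fin (p + q + 1)))
    (h : NicePerm p (p + q + 1) σ) : permS (lowS p σ) = σ := by
  classical
  ext i
  rw [permS_val, ← perm_rank σ i]
  unfold rankS
  congr 1
  ext j
  simp only [Finset.mem_filter, Finset.mem_univ, true_and, RelS, lowS]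
  rcases lt_trichotomy i j with hij | hij | hij
  · have := h _ _ hij
    simp only [Fin.lt_def] at *
    omega
  · subst hij
    simp
  · have := h _ _ hij
    simp only [Fin.lt_def] at *
    omega

theorem low_permS {n : ℕ} (p : ℕ) (S : Finset (Fin n)) (hS : S.card = p) :
    lowS p (permS S) = S := by
  ext i
  rw [lowS, Finset.mem_filter, permS_val]
  simp only [Finset.mem_univ, true_and]
  constructor
  · intro h
    by_contra hc
    have := rank_not_mem S i hc
    omega
  · intro h
    have := rank_mem S i h
    omega

noncomputable def crucialEquiv (p q : ℕ) :
    {σ : Equiv.Perm (Fin (p + q + 1)) // RightCrucial (p + 2) (q + 2) (p + q + 1) ⇑σ} ≃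
    {S : Finset (Fin (p + q + 1)) //
      S ∈ Finset.powersetCard p (Finset.univ.erase (Fin.last (p + q)))} where
  toFun σ := ⟨lowS p σ.1, by
    rw [Finset.mem_powersetCard]
    refine ⟨?_, low_card p q σ.1⟩
    intro x hx
    rw [Finset.mem_erase]
    refine ⟨?_, Finset.mem_univ _⟩
    rintro rfl
    exact low_last p q σ.1 (crucial_nice p q σ.1 σ.2) hx⟩
  invFun S := ⟨permS S.1, nice_crucial p q _ (permS_nice p q S.1
    (Finset.mem_powersetCard.1 S.2).2
    (fun hc => (Finset.mem_erase.1 ((Finset.mem_powersetCard.1 S.2).1 hc)).1 rfl))⟩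
  left_inv σ := Subtype.ext (nice_eq p q σ.1 (crucial_nice p q σ.1 σ.2))
  right_inv S := Subtype.ext (low_permS p S.1 (Finset.mem_powersetCard.1 S.2).2)

/-- Corollary on minimal crucial permutations: the number of `(k,l)`-crucial
permutations of the minimal length `k+l-3` is the binomial coefficient `C(k+l-4, k-2)`. -/
theorem count_minimal_crucial (k l : ℕ) (hk : 2 ≤ k) (hl : 2 ≤ l) :
    Nat.card {σ : Equiv.Perm (Fin (k + l - 3)) // RightCrucial k l (k + l - 3) ⇑σ} =
      Nat.choose (k + l - 4) (k - 2) := by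
  obtain ⟨p, rfl⟩ := Nat.exists_eq_add_of_le' hk
  obtain ⟨q, rfl⟩ := Nat.exists_eq_add_of_le' hl
  have e1 : p + 2 + (q + 2) - 3 = p + q + 1 := by omega
  have e2 : p + 2 + (q + 2) - 4 = p + q := by omega
  have e3 : p + 2 - 2 = p := by omega
  rw [e1, e2, e3, Nat.card_congr (crucialEquiv p q),
    Nat.card_eq_fintype_card, Fintype.card_coe, Finset.card_powersetCard]
  simp
end

section
/- Let k, ℓ ≥ 3. Every (k,ℓ)-top-right-crucial permutation has length at least k+ℓ−3, and there is exactly one (k,ℓ)-top-right-crucial permutation of length k+ℓ−3, namely the permutation 1 2 ⋯ (k−2) (k+ℓ−3) (k+ℓ−4) ⋯ (k−1). -/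
/-- The permutation `1 2 ⋯ (k-2) (k+l-3) (k+l-4) ⋯ (k-1)` of length `k+l-3`
(0-based: position `j` gets value `j` for `j < k-2`, and value `2k+l-6-j` otherwise). -/
def minTRC (k l : ℕ) : Fin (k + l - 3) → Fin (k + l - 3) :=
  fun j =>
    if h : (j : ℕ) < k - 2 then j
    else ⟨2 * k + l - 6 - (j : ℕ), by have := j.isLt; omega⟩

theorem ext_inc {K n : ℕ} (F : Fin (n+1) → Fin (n+1)) (p : Fin (n+1)) (σ : Fin n → Fin n)
    (hF : ∀ a b, F (p.succAbove a) < F (p.succAbove b) ↔ σ a < σ b)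
    (hav : ¬ HasIncr (K+1) n σ) (h : HasIncr (K+1) (n+1) F) :
    ∃ f' : Fin K → Fin n, StrictMono f' ∧ StrictMono (σ ∘ f') ∧
      ∀ j, (p.succAbove (f' j) < p ∧ F (p.succAbove (f' j)) < F p) ∨
        (p < p.succAbove (f' j) ∧ F p < F (p.succAbove (f' j))) := by
  obtain ⟨f, hf, hFf⟩ := h
  by_cases hp : ∃ q, f q = p
  · obtain ⟨q, hq⟩ := hp
    have hne : ∀ j, f (q.succAbove j) ≠ p := fun j e =>
      Fin.succAbove_ne q j (hf.injective (e.trans hq.symm))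
    have : ∀ j, ∃ x, p.succAbove x = f (q.succAbove j) := fun j => Fin.exists_succAbove_eq (hne j)
    choose f' hf' using this
    refine ⟨f', ?_, ?_, ?_⟩
    · intro a b hab
      rw [← Fin.succAbove_lt_succAbove_iff (p := p), hf', hf']
      exact hf (Fin.strictMono_succAbove q hab)
    · intro a b hab
      simp only [Function.comp]
      rw [← hF, hf', hf']
      exact hFf (Fin.strictMono_succAbove q hab)
    · intro j
      rw [hf', ← hq]
      rcases lt_or_gt_of_ne (Fin.succAbove_ne q j) with h | h
      · exact Or.inl ⟨hf h, hFf h⟩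
      · exact Or.inr ⟨hf h, hFf h⟩
  · exfalso
    push Not at hp
    have : ∀ j, ∃ x, p.succAbove x = f j := fun j => Fin.exists_succAbove_eq (hp j)
    choose f' hf' using this
    refine hav ⟨f', ?_, ?_⟩
    · intro a b hab
      rw [← Fin.succAbove_lt_succAbove_iff (p := p), hf', hf']
      exact hf hab
    · intro a b hab
      simp only [Function.comp]
      rw [← hF, hf', hf']
      exact hFf hab

theorem ext_dec {K n : ℕ} (F : Fin (n+1) → Fin (n+1)) (p : Fin (n+1)) (σ : Fin n → Fin n)
    (hF : ∀ a b, F (p.succAbove a) < F (p.succAbove b) ↔ σ a < σ b)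
    (hav : ¬ HasDecr (K+1) n σ) (h : HasDecr (K+1) (n+1) F) :
    ∃ f' : Fin K → Fin n, StrictMono f' ∧ StrictAnti (σ ∘ f') ∧
      ∀ j, (p.succAbove (f' j) < p ∧ F p < F (p.succAbove (f' j))) ∨
        (p < p.succAbove (f' j) ∧ F (p.succAbove (f' j)) < F p) := by
  obtain ⟨f, hf, hFf⟩ := h
  by_cases hp : ∃ q, f q = p
  · obtain ⟨q, hq⟩ := hp
    have hne : ∀ j, f (q.succAbove j) ≠ p := fun j e =>
      Fin.succAbove_ne q j (hf.injective (e.trans hq.symm))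
    have : ∀ j, ∃ x, p.succAbove x = f (q.succAbove j) := fun j => Fin.exists_succAbove_eq (hne j)
    choose f' hf' using this
    refine ⟨f', ?_, ?_, ?_⟩
    · intro a b hab
      rw [← Fin.succAbove_lt_succAbove_iff (p := p), hf', hf']
      exact hf (Fin.strictMono_succAbove q hab)
    · intro a b hab
      simp only [Function.comp]
      rw [← hF, hf', hf']
      exact hFf (Fin.strictMono_succAbove q hab)
    · intro j
      rw [hf', ← hq]
      rcases lt_or_gt_of_ne (Fin.succAbove_ne q j) with h | h
      · exact Or.inl ⟨hf h, hFf h⟩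
      · exact Or.inr ⟨hf h, hFf h⟩
  · exfalso
    push Not at hp
    have : ∀ j, ∃ x, p.succAbove x = f j := fun j => Fin.exists_succAbove_eq (hp j)
    choose f' hf' using this
    refine hav ⟨f', ?_, ?_⟩
    · intro a b hab
      rw [← Fin.succAbove_lt_succAbove_iff (p := p), hf', hf']
      exact hf hab
    · intro a b hab
      simp only [Function.comp]
      rw [← hF, hf', hf']
      exact hFf hab

theorem rightExt_succAbove {n : ℕ} (σ : Fin n → Fin n) (i : Fin (n+1)) (a : Fin n) :
    rightExt σ i ((Fin.last n).succAbove a) = i.succAbove (σ a) := by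
  simp [rightExt]

theorem rightExt_last {n : ℕ} (σ : Fin n → Fin n) (i : Fin (n+1)) :
    rightExt σ i (Fin.last n) = i := by
  simp [rightExt]

theorem topExt_succAbove {n : ℕ} (σ : Fin n → Fin n) (i : Fin (n+1)) (a : Fin n) :
    topExt σ i (i.succAbove a) = (σ a).castSucc := by
  simp [topExt]

theorem topExt_self {n : ℕ} (σ : Fin n → Fin n) (i : Fin (n+1)) :
    topExt σ i i = Fin.last n := by
  simp [topExt]

theorem right_split {K L n : ℕ} {σ : Fin n → Fin n} (h : RightCrucial (K+1) (L+1) n σ)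
    (m : ℕ) (hm : m ≤ n) :
    (∃ f : Fin K → Fin n, StrictMono f ∧ StrictMono (σ ∘ f) ∧ ∀ j, (σ (f j) : ℕ) < m) ∨
    (∃ f : Fin L → Fin n, StrictMono f ∧ StrictAnti (σ ∘ f) ∧ ∀ j, m ≤ (σ (f j) : ℕ)) := by
  obtain ⟨⟨h1, h2⟩, h3⟩ := h
  have hF : ∀ a b, rightExt σ ⟨m, by omega⟩ ((Fin.last n).succAbove a)
      < rightExt σ ⟨m, by omega⟩ ((Fin.last n).succAbove b) ↔ σ a < σ b := by
    intro a b
    rw [rightExt_succAbove, rightExt_succAbove, Fin.succAbove_lt_succAbove_iff]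
  rcases h3 ⟨m, by omega⟩ with h | h
  · left
    obtain ⟨f, hf, hs, hc⟩ := ext_inc _ (Fin.last n) σ hF h1 h
    refine ⟨f, hf, hs, fun j => ?_⟩
    rcases hc j with ⟨_, h⟩ | ⟨h, _⟩
    · rw [rightExt_succAbove, rightExt_last, Fin.succAbove_lt_iff_castSucc_lt] at h
      exact h
    · exact absurd (Fin.le_last _) (not_le.2 h)
  · right
    obtain ⟨f, hf, hs, hc⟩ := ext_dec _ (Fin.last n) σ hF h2 h
    refine ⟨f, hf, hs, fun j => ?_⟩
    rcases hc j with ⟨_, h⟩ | ⟨h, _⟩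
    · rw [rightExt_succAbove, rightExt_last, Fin.lt_succAbove_iff_le_castSucc] at h
      exact h
    · exact absurd (Fin.le_last _) (not_le.2 h)

theorem top_split {K L n : ℕ} {σ : Fin n → Fin n} (h : TopRightCrucial (K+1) (L+1) n σ)
    (m : ℕ) (hm : m ≤ n) :
    (∃ f : Fin K → Fin n, StrictMono f ∧ StrictMono (σ ∘ f) ∧ ∀ j, (f j : ℕ) < m) ∨
    (∃ f : Fin L → Fin n, StrictMono f ∧ StrictAnti (σ ∘ f) ∧ ∀ j, m ≤ (f j : ℕ)) := by
  obtain ⟨⟨⟨h1, h2⟩, _⟩, h3⟩ := h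
  set i : Fin (n+1) := ⟨m, by omega⟩ with hi
  have hF : ∀ a b, topExt σ i (i.succAbove a)
      < topExt σ i (i.succAbove b) ↔ σ a < σ b := by
    intro a b
    rw [topExt_succAbove, topExt_succAbove, Fin.castSucc_lt_castSucc_iff]
  rcases h3 i with h | h
  · left
    obtain ⟨f, hf, hs, hc⟩ := ext_inc _ i σ hF h1 h
    refine ⟨f, hf, hs, fun j => ?_⟩
    rcases hc j with ⟨h, _⟩ | ⟨_, h⟩
    · rw [Fin.succAbove_lt_iff_castSucc_lt] at h
      exact h
    · rw [topExt_self] at h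
      exact absurd (Fin.le_last _) (not_le.2 h)
  · right
    obtain ⟨f, hf, hs, hc⟩ := ext_dec _ i σ hF h2 h
    refine ⟨f, hf, hs, fun j => ?_⟩
    rcases hc j with ⟨_, h⟩ | ⟨h, _⟩
    · rw [topExt_self] at h
      exact absurd (Fin.le_last _) (not_le.2 h)
    · rw [Fin.lt_succAbove_iff_le_castSucc] at h
      exact h

theorem split_pivot {K L n : ℕ} {σ : Fin n → Fin n} (φ : Fin n → Fin n) (hK : 0 < K) (hL : 0 < L)
    (h : ∀ m, m ≤ n → 
    (∃ f : Fin K → Fin n, StrictMono f ∧ StrictMono (σ ∘ f) ∧ ∀ j, (φ (f j) : ℕ) < m) ∨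
    (∃ f : Fin L → Fin n, StrictMono f ∧ StrictAnti (σ ∘ f) ∧ ∀ j, m ≤ (φ (f j) : ℕ))) :
    ∃ (c : ℕ) (f : Fin K → Fin n) (g : Fin L → Fin n), StrictMono f ∧ StrictMono (σ ∘ f) ∧
      StrictMono g ∧ StrictAnti (σ ∘ g) ∧ (∀ j, (φ (f j) : ℕ) ≤ c) ∧ (∀ j, c ≤ (φ (g j) : ℕ)) := by
  classical
  have hP : ∃ m, ∃ f : Fin K → Fin n, StrictMono f ∧ StrictMono (σ ∘ f) ∧ ∀ j, (φ (f j) : ℕ) < m := by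
    rcases h n le_rfl with h | ⟨f, _, _, h⟩
    · exact ⟨n, h⟩
    · have := h ⟨0, hL⟩
      omega
  have hs := Nat.find_spec hP
  have hn : Nat.find hP ≤ n := by
    apply Nat.find_min'
    rcases h n le_rfl with h | ⟨f, _, _, h⟩
    · exact h
    · have := h ⟨0, hL⟩
      omega
  obtain ⟨f, hf, hsf, hc⟩ := hs
  have h0 := hc ⟨0, hK⟩
  have hmin := Nat.find_min hP (m := Nat.find hP - 1) (by omega)
  obtain ⟨g, hg, hsg, hd⟩ := (h (Nat.find hP - 1) (by omega)).resolve_left hmin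
  exact ⟨Nat.find hP - 1, f, g, hf, hsf, hg, hsg, fun j => by have := hc j; omega, hd⟩

/-- an increasing and a decreasing chain meet in at most one point -/
theorem chain_meet {K L n : ℕ} {σ : Fin n → Fin n} {f : Fin K → Fin n} {g : Fin L → Fin n}
    (hf : StrictMono f) (hsf : StrictMono (σ ∘ f)) (hg : StrictMono g) (hsg : StrictAnti (σ ∘ g))
    {a b c d} (h1 : f a = g b) (h2 : f c = g d) : f a = f c := by
  by_contra hne
  wlog h : a < c generalizing a b c d
  · have hca : c < a := lt_of_le_of_ne (not_lt.1 h) (fun e => hne (by rw [e]))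
    exact this h2 h1 (fun e => hne e.symm) hca
  have h3 := hsf h
  have h4 : b < d := by rw [← hg.lt_iff_lt, ← h1, ← h2]; exact hf h
  have h5 := hsg h4
  simp only [Function.comp] at h3 h5
  rw [← h1, ← h2] at h5
  exact lt_asymm h3 h5

theorem chain_card {K L n : ℕ} {σ : Fin n → Fin n} {f : Fin K → Fin n} {g : Fin L → Fin n}
    (hf : StrictMono f) (hsf : StrictMono (σ ∘ f)) (hg : StrictMono g) (hsg : StrictAnti (σ ∘ g)) :
    K + L ≤ n + 1 ∧ (K + L = n + 1 → (∃ a b, f a = g b) ∧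
      ∀ x, (∃ a, f a = x) ∨ (∃ b, g b = x)) := by
  classical
  set A := Finset.univ.image f
  set B := Finset.univ.image g
  have hA : A.card = K := by
    rw [Finset.card_image_of_injective _ hf.injective]; simp
  have hB : B.card = L := by
    rw [Finset.card_image_of_injective _ hg.injective]; simp
  have hI : (A ∩ B).card ≤ 1 := by
    rw [Finset.card_le_one]
    intro x hx y hy
    simp only [A, B, Finset.mem_inter, Finset.mem_image, Finset.mem_univ, true_and] at hx hy
    obtain ⟨⟨a, rfl⟩, b, hb⟩ := hx
    obtain ⟨⟨c, rfl⟩, d, hd⟩ := hy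
    exact chain_meet hf hsf hg hsg hb.symm hd.symm
  have hU : (A ∪ B).card ≤ n := by simpa using Finset.card_le_univ (A ∪ B)
  have := Finset.card_union_add_card_inter A B
  refine ⟨by omega, fun h => ⟨?_, ?_⟩⟩
  · have : 0 < (A ∩ B).card := by omega
    obtain ⟨x, hx⟩ := Finset.card_pos.1 this
    simp only [A, B, Finset.mem_inter, Finset.mem_image, Finset.mem_univ, true_and] at hx
    obtain ⟨⟨a, rfl⟩, b, hb⟩ := hx
    exact ⟨a, b, hb.symm⟩
  · intro x
    have : A ∪ B = Finset.univ := by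
      rw [← Finset.card_eq_iff_eq_univ]
      simp; omega
    have hx : x ∈ A ∪ B := by rw [this]; simp
    simpa [A, B] using hx

/-- structure: pivot -/
theorem pivot_struct {K L n : ℕ} {σ : Fin n → Fin n} (φ : Fin n → Fin n) (hφ : Function.Bijective φ)
    (hK : 0 < K) (hL : 0 < L) (hn : K + L = n + 1)
    (h : ∀ m, m ≤ n → 
    (∃ f : Fin K → Fin n, StrictMono f ∧ StrictMono (σ ∘ f) ∧ ∀ j, (φ (f j) : ℕ) < m) ∨
    (∃ f : Fin L → Fin n, StrictMono f ∧ StrictAnti (σ ∘ f) ∧ ∀ j, m ≤ (φ (f j) : ℕ))) :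
    (∀ x y, (φ x : ℕ) < K → (φ y : ℕ) < K → (x < y ↔ σ x < σ y)) ∧ 
    (∀ x y, K ≤ (φ x : ℕ) + 1 → K ≤ (φ y : ℕ) + 1 → (x < y ↔ σ y < σ x)) := by
  classical
  obtain ⟨c, f, g, hf, hsf, hg, hsg, hc, hd⟩ := split_pivot φ hK hL h
  obtain ⟨⟨a, b, hab⟩, hcov⟩ := (chain_card hf hsf hg hsg).2 hn
  have hca : (φ (f a) : ℕ) = c := le_antisymm (hc a) (hab ▸ hd b)
  have hfr : ∀ x, (φ x : ℕ) ≤ c ↔ ∃ a, f a = x := by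
    intro x
    constructor
    · intro hx
      rcases hcov x with h | ⟨b', hb⟩
      · exact h
      · have := hd b'
        rw [hb] at this
        exact ⟨a, hφ.1 (Fin.ext (by omega))⟩
    · rintro ⟨a, rfl⟩; exact hc a
  have hgr : ∀ x, c ≤ (φ x : ℕ) → ∃ a, g a = x := by
    intro x hx
    rcases hcov x with ⟨a', ha⟩ | h
    · have := hc a'
      rw [ha] at this
      exact ⟨b, hφ.1 (Fin.ext (by rw [← hab]; omega))⟩
    · exact h
  have hcn : c < n := by rw [← hca]; exact (φ (f a)).isLt
  have hcK : c + 1 = K := by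
    have e : (Finset.univ.image (fun j => φ (f j))) = Finset.Iic (⟨c, hcn⟩ : Fin n) := by
      ext y
      obtain ⟨x, rfl⟩ := hφ.2 y
      have := hfr x
      simp only [Finset.mem_image, Finset.mem_univ, true_and, Finset.mem_Iic, hφ.1.eq_iff, Fin.le_def]
      exact this.symm
    have e2 := congrArg Finset.card e
    rw [Finset.card_image_of_injective _ (show Function.Injective (fun j => φ (f j)) from hφ.1.comp hf.injective)] at e2
    simp at e2
    omega
  constructor
  · intro x y hx hy
    obtain ⟨u, rfl⟩ := (hfr x).1 (by omega)
    obtain ⟨v, rfl⟩ := (hfr y).1 (by omega)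
    rw [hf.lt_iff_lt]; exact hsf.lt_iff_lt.symm
  · intro x y hx hy
    obtain ⟨u, rfl⟩ := hgr x (by omega)
    obtain ⟨v, rfl⟩ := hgr y (by omega)
    rw [hg.lt_iff_lt]; exact hsg.lt_iff_gt.symm

theorem unique_aux {K L : ℕ} (hK : 2 ≤ K) (hL : 2 ≤ L) (n : ℕ) (hn : K + L = n + 1)
    (σ : Fin n → Fin n) (hσ : Function.Bijective σ) (h : TopRightCrucial (K+1) (L+1) n σ)
    (x : Fin n) : (σ x : ℕ) = if (x : ℕ) < K - 1 then (x : ℕ) else K - 1 + (n - 1) - x := by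
  obtain ⟨t1, t2⟩ := pivot_struct (σ := σ) id Function.bijective_id (by omega) (by omega) hn (top_split h)
  obtain ⟨r1, r2⟩ := pivot_struct (σ := σ) σ hσ (by omega) (by omega) hn (right_split h.1)
  simp only [id] at t1 t2
  obtain ⟨x0, hx0⟩ := hσ.2 ⟨K-1, by omega⟩
  have hx0v : (σ x0 : ℕ) = K - 1 := by rw [hx0]
  have hlast : (x0 : ℕ) = n - 1 := by
    by_contra hne
    have hlt : x0 < ⟨n-1, by omega⟩ := by
      rw [Fin.lt_def]; simp; omega
    rcases lt_trichotomy (σ x0) (σ ⟨n-1, by omega⟩) with h | h | h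
    · have := (r2 ⟨n-1, by omega⟩ x0 (by rw [Fin.lt_def] at h; omega) (by omega)).2 h
      exact lt_asymm this hlt
    · exact hlt.ne (hσ.1 h)
    · have := (r1 ⟨n-1, by omega⟩ x0 (by rw [Fin.lt_def] at h; omega) (by omega)).2 h
      exact lt_asymm this hlt
  have up : ∀ d (x : Fin n), (x : ℕ) = K - 1 + d → (σ x : ℕ) + d ≤ n - 1 := by
    intro d
    induction d with
    | zero => intro x _; omega
    | succ d ih =>
      intro x hx
      have h1 := ih ⟨K-1+d, by omega⟩ rfl
      have h2 := (t2 ⟨K-1+d, by omega⟩ x (by simp; omega) (by omega)).1 (by rw [Fin.lt_def]; simp; omega)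
      rw [Fin.lt_def] at h2
      omega
  have down : ∀ d (x : Fin n), (x : ℕ) + d = n - 1 → K - 1 ≤ (x : ℕ) → K - 1 + d ≤ (σ x : ℕ) := by
    intro d
    induction d with
    | zero => 
      intro x hx _
      have : x = x0 := Fin.ext (by omega)
      rw [this]; omega
    | succ d ih =>
      intro x hx hx'
      have h1 := ih ⟨x+1, by omega⟩ (by simp; omega) (by simp; omega)
      have h2 := (t2 x ⟨x+1, by omega⟩ (by omega) (by simp; omega)).1 (by rw [Fin.lt_def]; simp)
      rw [Fin.lt_def] at h2
      omega
  have hi : ∀ x : Fin n, K - 1 ≤ (x : ℕ) → (σ x : ℕ) = K - 1 + (n - 1) - x := by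
    intro x hx
    have h1 := up (x - (K-1)) x (by omega)
    have h2 := down (n - 1 - x) x (by omega) hx
    omega
  have lo : ∀ x : Fin n, (x : ℕ) < K - 1 → (σ x : ℕ) < K - 1 := by
    intro x hx
    by_contra hc
    have h1 := hi ⟨K - 1 + (n-1) - σ x, by omega⟩ (by simp; omega)
    have h2 := hσ.1 (Fin.ext (by rw [h1]; simp; omega) : σ ⟨K - 1 + (n-1) - σ x, by omega⟩ = σ x)
    have h3 := congrArg Fin.val h2
    simp at h3
    omega
  split_ifs with hx
  · have a1 : ∀ d (x : Fin n), (x : ℕ) = d → d < K - 1 → d ≤ σ x := by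
      intro d
      induction d with
      | zero => intros; omega
      | succ d ih =>
        intro x hx hx'
        have h1 := ih ⟨d, by omega⟩ rfl (by omega)
        have h2 := (t1 ⟨d, by omega⟩ x (by simp; omega) (by omega)).1 (by rw [Fin.lt_def]; simp; omega)
        rw [Fin.lt_def] at h2
        omega
    have a2 : ∀ d (x : Fin n), (x : ℕ) + d = K - 2 → (σ x : ℕ) + d ≤ K - 2 := by
      intro d
      induction d with
      | zero => intro x hx; have := lo x (by omega); omega
      | succ d ih =>
        intro x hx
        have h1 := ih ⟨x+1, by omega⟩ (by simp; omega)
        have h2 := (t1 x ⟨x+1, by omega⟩ (by omega) (by simp; omega)).1 (by rw [Fin.lt_def]; simp)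
        rw [Fin.lt_def] at h2
        omega
    have := a1 x x rfl hx
    have := a2 (K - 2 - x) x (by omega)
    omega
  · exact hi x (by omega)

theorem minTRC_val (k l : ℕ) (x : Fin (k + l - 3)) :
    (minTRC k l x : ℕ) = if (x : ℕ) < k - 2 then (x : ℕ) else 2 * k + l - 6 - x := by
  unfold minTRC
  split_ifs <;> rfl

theorem rightExt_val {n : ℕ} (σ : Fin n → Fin n) (i x : Fin (n+1)) (h : (x : ℕ) < n) :
    (rightExt σ i x : ℕ) = if (σ ⟨x, h⟩ : ℕ) < i then (σ ⟨x, h⟩ : ℕ) else σ ⟨x, h⟩ + 1 := by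
  have : x = (Fin.last n).succAbove ⟨x, h⟩ := by simp
  conv_lhs => rw [this]
  rw [rightExt_succAbove, Fin.succAbove]
  simp only [Fin.lt_def, Fin.val_castSucc]
  split_ifs <;> simp

theorem topExt_lt {n : ℕ} (σ : Fin n → Fin n) (i x : Fin (n+1)) (h : (x : ℕ) < i) :
    (topExt σ i x : ℕ) = σ ⟨x, by omega⟩ := by
  have : x = i.succAbove ⟨x, by omega⟩ := by
    rw [Fin.succAbove_of_castSucc_lt]
    · simp
    · rw [Fin.lt_def]; simpa using h
  conv_lhs => rw [this]
  rw [topExt_succAbove]; simp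

theorem topExt_gt {n : ℕ} (σ : Fin n → Fin n) (i x : Fin (n+1)) (h : (i : ℕ) < x) :
    (topExt σ i x : ℕ) = σ ⟨x - 1, by omega⟩ := by
  have : x = i.succAbove ⟨x - 1, by omega⟩ := by
    rw [Fin.succAbove_of_le_castSucc]
    · ext; simp; omega
    · rw [Fin.le_def]; simp; omega
  conv_lhs => rw [this]
  rw [topExt_succAbove]; simp

theorem minTRC_inj (k l : ℕ) (hk : 3 ≤ k) (hl : 3 ≤ l) : Function.Injective (minTRC k l) := by
  intro x y h
  have h := congrArg Fin.val h
  rw [minTRC_val, minTRC_val] at h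
  ext
  split_ifs at h <;> omega

theorem le_strictMono {k n : ℕ} (f : Fin k → Fin n) (hf : StrictMono f) (c : ℕ) :
    ∀ (d : ℕ) (h : d < k), c ≤ (f ⟨0, by omega⟩ : ℕ) → c + d ≤ (f ⟨d, h⟩ : ℕ) := by
  intro d
  induction d with
  | zero => intro h hc; exact hc
  | succ d ih =>
    intro h hc
    have h1 := ih (by omega) hc
    have h2 : f ⟨d, by omega⟩ < f ⟨d+1, h⟩ := hf (by rw [Fin.lt_def]; simp)
    rw [Fin.lt_def] at h2
    omega

theorem minTRC_avoids (k l : ℕ) (hk : 3 ≤ k) (hl : 3 ≤ l) : AvoidsPat k l _ (minTRC k l) := by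
  constructor
  · rintro ⟨f, hf, hs⟩
    have h1 := le_strictMono f hf 0 (k-2) (by omega) (by omega)
    have h2 := hf (show (⟨k-2, by omega⟩ : Fin k) < ⟨k-1, by omega⟩ by rw [Fin.lt_def]; simp; omega)
    have h3 := hs (show (⟨k-2, by omega⟩ : Fin k) < ⟨k-1, by omega⟩ by rw [Fin.lt_def]; simp; omega)
    simp only [Function.comp, Fin.lt_def, minTRC_val] at h2 h3
    split_ifs at h3 <;> omega
  · rintro ⟨f, hf, hs⟩
    have h1 := le_strictMono f hf (k-2) (l-1) (by omega)
    have h2 := hf (show (⟨0, by omega⟩ : Fin l) < ⟨1, by omega⟩ by rw [Fin.lt_def]; simp)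
    have h3 := hs (show (⟨0, by omega⟩ : Fin l) < ⟨1, by omega⟩ by rw [Fin.lt_def]; simp)
    simp only [Function.comp, Fin.lt_def, minTRC_val] at h2 h3
    split_ifs at h3 <;> omega

theorem minTRC_right (k l : ℕ) (hk : 3 ≤ k) (hl : 3 ≤ l) (i : Fin (k + l - 3 + 1)) :
    ContainsPat k l _ (rightExt (minTRC k l) i) := by
  by_cases hi : (i : ℕ) ≤ k - 2
  · right
    refine ⟨fun j => ⟨k - 2 + j, by omega⟩, ?_, ?_⟩
    · intro a b hab
      rw [Fin.lt_def] at hab ⊢; simp; omega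
    · intro a b hab
      rw [Fin.lt_def] at hab ⊢
      simp only [Function.comp]
      rw [rightExt_val _ _ ⟨k - 2 + a, _⟩ (by simp; omega)]
      simp only [minTRC_val]
      by_cases hb : (b : ℕ) = l - 1
      · have : (⟨k - 2 + b, by omega⟩ : Fin (k + l - 3 + 1)) = Fin.last _ := by
          ext; simp; omega
        rw [this, rightExt_last]
        split_ifs <;> omega
      · rw [rightExt_val _ _ ⟨k - 2 + b, _⟩ (by simp; omega)]
        simp only [minTRC_val]
        split_ifs <;> omega
  · left
    refine ⟨fun j => ⟨if (j : ℕ) < k - 2 then j else l - 2 + j, by split_ifs <;> omega⟩, ?_, ?_⟩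
    · intro a b hab
      rw [Fin.lt_def] at hab ⊢; simp only; split_ifs <;> omega
    · intro a b hab
      rw [Fin.lt_def] at hab ⊢
      simp only [Function.comp]
      rw [rightExt_val _ _ ⟨if (a : ℕ) < k - 2 then a else l - 2 + a, _⟩ (by simp only; split_ifs <;> omega)]
      simp only [minTRC_val]
      by_cases hb : (b : ℕ) = k - 1
      · have : (⟨if (b : ℕ) < k - 2 then b else l - 2 + b, by split_ifs <;> omega⟩ : Fin (k + l - 3 + 1)) = Fin.last _ := by
          ext; simp only [Fin.val_last]; split_ifs <;> omega
        rw [this, rightExt_last]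
        split_ifs <;> omega
      · rw [rightExt_val _ _ ⟨if (b : ℕ) < k - 2 then b else l - 2 + b, _⟩ (by simp only; split_ifs <;> omega)]
        simp only [minTRC_val]
        split_ifs <;> omega

theorem minTRC_top (k l : ℕ) (hk : 3 ≤ k) (hl : 3 ≤ l) (i : Fin (k + l - 3 + 1)) :
    ContainsPat k l _ (topExt (minTRC k l) i) := by
  by_cases hi : (i : ℕ) ≤ k - 2
  · right
    refine ⟨fun j => ⟨if (j : ℕ) = 0 then i else k - 2 + j, by split_ifs <;> omega⟩, ?_, ?_⟩
    · intro a b hab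
      rw [Fin.lt_def] at hab ⊢; simp only; split_ifs <;> omega
    · intro a b hab
      rw [Fin.lt_def] at hab ⊢
      simp only [Function.comp]
      rw [topExt_gt _ _ ⟨if (b : ℕ) = 0 then i else k - 2 + b, _⟩ (by simp only; split_ifs <;> omega)]
      simp only [minTRC_val]
      by_cases ha : (a : ℕ) = 0
      · have : (⟨if (a : ℕ) = 0 then i else k - 2 + a, by split_ifs <;> omega⟩ : Fin (k + l - 3 + 1)) = i := by
          ext; simp only; split_ifs; omega
        rw [this, topExt_self, Fin.val_last]
        split_ifs <;> omega
      · rw [topExt_gt _ _ ⟨if (a : ℕ) = 0 then i else k - 2 + a, _⟩ (by simp only; split_ifs; omega)]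
        simp only [minTRC_val]
        split_ifs <;> omega
  · left
    refine ⟨fun j => ⟨if (j : ℕ) = k - 1 then i else j, by split_ifs <;> omega⟩, ?_, ?_⟩
    · intro a b hab
      rw [Fin.lt_def] at hab ⊢; simp only; split_ifs <;> omega
    · intro a b hab
      rw [Fin.lt_def] at hab ⊢
      simp only [Function.comp]
      rw [topExt_lt _ _ ⟨if (a : ℕ) = k - 1 then i else a, _⟩ (by simp only; split_ifs <;> omega)]
      simp only [minTRC_val]
      by_cases hb : (b : ℕ) = k - 1
      · have : (⟨if (b : ℕ) = k - 1 then i else b, by split_ifs <;> omega⟩ : Fin (k + l - 3 + 1)) = i := by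
          ext; simp only; split_ifs; omega
        rw [this, topExt_self, Fin.val_last]
        split_ifs <;> omega
      · rw [topExt_lt _ _ ⟨if (b : ℕ) = k - 1 then i else b, _⟩ (by simp only; split_ifs; omega)]
        simp only [minTRC_val]
        split_ifs <;> omega

/-- Theorem on minimal top-right-crucial permutations: for `k, l ≥ 3`, every
`(k,l)`-top-right-crucial permutation has length at least `k+l-3`, and there is exactly one
of length `k+l-3`, namely `1 2 ⋯ (k-2) (k+l-3) (k+l-4) ⋯ (k-1)`. -/
theorem minimal_topRightCrucial (k l : ℕ) (hk : 3 ≤ k) (hl : 3 ≤ l) :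
    (∀ (n : ℕ) (σ : Fin n → Fin n), Function.Bijective σ →
      TopRightCrucial k l n σ → k + l - 3 ≤ n) ∧
    (∃ σ : Equiv.Perm (Fin (k + l - 3)),
      ⇑σ = minTRC k l ∧ TopRightCrucial k l (k + l - 3) ⇑σ) ∧
    (∀ σ : Equiv.Perm (Fin (k + l - 3)),
      TopRightCrucial k l (k + l - 3) ⇑σ → ⇑σ = minTRC k l) := by
  refine ⟨?_, ?_, ?_⟩
  · intro n σ _ h
    obtain ⟨K, rfl⟩ : ∃ K, k = K + 1 := ⟨k - 1, by omega⟩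
    obtain ⟨L, rfl⟩ : ∃ L, l = L + 1 := ⟨l - 1, by omega⟩
    obtain ⟨c, f, g, hf, hsf, hg, hsg, _⟩ :=
      split_pivot (σ := σ) id (by omega) (by omega) (top_split h)
    have := (chain_card hf hsf hg hsg).1
    omega
  · have hb : Function.Bijective (minTRC k l) :=
      Finite.injective_iff_bijective.1 (minTRC_inj k l hk hl)
    exact ⟨Equiv.ofBijective _ hb, rfl,
      ⟨minTRC_avoids k l hk hl, minTRC_right k l hk hl⟩, minTRC_top k l hk hl⟩
  · intro σ h
    obtain ⟨K, rfl⟩ : ∃ K, k = K + 1 := ⟨k - 1, by omega⟩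
    obtain ⟨L, rfl⟩ : ∃ L, l = L + 1 := ⟨l - 1, by omega⟩
    funext x
    ext
    rw [unique_aux (K := K) (L := L) (by omega) (by omega) _ (by omega) σ σ.bijective h x,
      minTRC_val]
    split_ifs <;> omega
end
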